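/- arXiv:1612.06229 — 2 statements merged into one kernel-verified Lean document; each statement's English description precedes it below -/
import Mathlib

section
/- Let μ ≠ ν be two probability measures with compact support on ℝ^d with μ absolutely continuous with respect to Lebesgue measure, and let c_t be a relativistic cost function. Then for every t > T (T the critical time), C(s) → C(t) as s ↗ t, i.e. C is left-continuous at every supercritical time. -/
open MeasureTheory Set Filter Topology
open scoped ENNReal Pointwise

noncomputable section

/-- A relativistic cost structure: a closed, bounded, convex set `C` containing the
origin in its interior, together with a function `h` which is strictly convex and
bounded on `C`, vanishing at the origin, and identically `+∞` outside `C`. -/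
structure RelCost (d : ℕ) where
  C : Set (EuclideanSpace ℝ (Fin d))
  h : EuclideanSpace ℝ (Fin d) → ℝ≥0∞
  isClosed : IsClosed C
  isBounded : Bornology.IsBounded C
  convex : Convex ℝ C
  zero_mem_interior : (0 : EuclideanSpace ℝ (Fin d)) ∈ interior C
  h_zero : h 0 = 0
  h_strictConvexOn : ∀ x ∈ C, ∀ y ∈ C, x ≠ y → ∀ a b : ℝ, 0 < a → 0 < b → a + b = 1 →
    h (a • x + b • y) < ENNReal.ofReal a * h x + ENNReal.ofReal b * h y
  h_bddOn : ∃ M : ℝ≥0∞, M ≠ ⊤ ∧ ∀ z ∈ C, h z ≤ M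
  h_top : ∀ z, z ∉ C → h z = ⊤

/-- The set of transport plans between `μ` and `ν`. -/
def Plans {d : ℕ} (μ ν : Measure (EuclideanSpace ℝ (Fin d))) :
    Set (Measure (EuclideanSpace ℝ (Fin d) × EuclideanSpace ℝ (Fin d))) :=
  {γ | IsProbabilityMeasure γ ∧ γ.map Prod.fst = μ ∧ γ.map Prod.snd = ν}

/-- The cost of a transport plan `γ` at time `t`, for the relativistic cost
`c_t (x, y) = h ((y - x) / t)`. -/
def transportCost {d : ℕ} (R : RelCost d) (t : ℝ)
    (γ : Measure (EuclideanSpace ℝ (Fin d) × EuclideanSpace ℝ (Fin d))) : ℝ≥0∞ :=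
  ∫⁻ p, R.h (t⁻¹ • (p.2 - p.1)) ∂γ

/-- The minimal transport cost `C(t)` between `μ` and `ν` at time `t`. -/
def minCost {d : ℕ} (R : RelCost d) (μ ν : Measure (EuclideanSpace ℝ (Fin d))) (t : ℝ) :
    ℝ≥0∞ :=
  ⨅ γ ∈ Plans μ ν, transportCost R t γ

/-- The critical time `T`. -/
def criticalTime {d : ℕ} (R : RelCost d) (μ ν : Measure (EuclideanSpace ℝ (Fin d))) : ℝ :=
  sInf {t : ℝ | 0 < t ∧ minCost R μ ν t ≠ ⊤}

section Translation

variable {E : Type*} [NormedAddCommGroup E] [NormedSpace ℝ E] [FiniteDimensional ℝ E]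
  [MeasurableSpace E] [BorelSpace E]

theorem tendsto_eLpNorm_sub_translate (vol : Measure E) [vol.IsAddHaarMeasure] {F : E → ℝ}
    (hF : MemLp F 1 vol) :
    Tendsto (fun w : E ↦ eLpNorm (fun x ↦ F x - F (x - w)) 1 vol) (𝓝 0) (𝓝 0) := by
  let g : C(E, C(E, E)) := (ContinuousMap.mk (fun a : E × E ↦ a.2 - a.1) (by fun_prop)).curry
  have hg : ∀ w, MeasurePreserving (g w) vol vol := fun w ↦ measurePreserving_sub_right vol w
  have h := Filter.Tendsto.compMeasurePreservingLp (l := 𝓝 (0 : E)) (g := g)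
    (tendsto_const_nhds (x := hF.toLp F)) (g.continuous.tendsto 0) hg (hg 0) ENNReal.one_ne_top
  have h0 : Lp.compMeasurePreserving (g 0) (hg 0) (hF.toLp F) = hF.toLp F := by
    rw [Lp.toLp_compMeasurePreserving]
    congr 1
    ext x
    simp [g]
  rw [h0, tendsto_iff_edist_tendsto_0] at h
  refine h.congr fun w ↦ ?_
  rw [edist_comm, Lp.toLp_compMeasurePreserving, Lp.edist_toLp_toLp]
  rfl

theorem tendsto_lintegral_tsub_translate (vol : Measure E) [vol.IsAddHaarMeasure] {f : E → ℝ≥0∞}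
    (hf : Measurable f) (hfi : ∫⁻ x, f x ∂vol ≠ ⊤) :
    Tendsto (fun w : E ↦ ∫⁻ x, (f x - f (x - w)) ∂vol) (𝓝 0) (𝓝 0) := by
  have hF : MemLp (fun x ↦ (f x).toReal) 1 vol :=
    memLp_one_iff_integrable.2 (integrable_toReal_of_lintegral_ne_top hf.aemeasurable hfi)
  refine tendsto_of_tendsto_of_tendsto_of_le_of_le tendsto_const_nhds
    (tendsto_eLpNorm_sub_translate vol hF) (fun _ ↦ zero_le) fun w ↦ ?_
  have hfin := ae_lt_top hf hfi
  have hfin' : ∀ᵐ x ∂vol, f (x - w) < ⊤ :=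
    (measurePreserving_sub_right vol w).quasiMeasurePreserving.ae hfin
  dsimp only
  rw [eLpNorm_one_eq_lintegral_enorm]
  refine lintegral_mono_ae ?_
  filter_upwards [hfin, hfin'] with x hx hx'
  lift f x to NNReal using hx.ne with a
  lift f (x - w) to NNReal using hx'.ne with b
  rw [← ENNReal.coe_sub]
  rw [Real.enorm_eq_ofReal_abs, ENNReal.coe_toReal, ENNReal.coe_toReal, ← ENNReal.ofReal_coe_nnreal]
  refine ENNReal.ofReal_le_ofReal ?_
  rw [NNReal.coe_sub_def]
  exact max_le (le_abs_self _) (abs_nonneg _)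

/-- A density on the first factor commutes with taking the first marginal. -/
theorem map_fst_withDensity_comp_fst {X Y : Type*} [MeasurableSpace X] [MeasurableSpace Y]
    (γ : Measure (X × Y)) {k : X → ℝ≥0∞} (hk : Measurable k) :
    (γ.withDensity fun p ↦ k p.1).map Prod.fst = (γ.map Prod.fst).withDensity k := by
  ext s hs
  rw [Measure.map_apply measurable_fst hs, withDensity_apply _ (measurable_fst hs),
    withDensity_apply _ hs, setLIntegral_map hs hk measurable_fst]

/-- If the first marginal of `γ` is absolutely continuous, then after a small translation of the
first coordinate, most of the mass of `γ` can be kept without exceeding the original first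
marginal. -/
theorem eventually_exists_le_map_translate_fst (vol : Measure E) [vol.IsAddHaarMeasure]
    {Y : Type*} [MeasurableSpace Y] (γ : Measure (E × Y)) [IsFiniteMeasure γ]
    (hac : γ.map Prod.fst ≪ vol) {θ : ℝ≥0∞} (hθ : θ ≠ 0) :
    ∀ᶠ w in 𝓝 (0 : E), ∃ σ : Measure (E × Y),
      σ ≤ γ.map (fun p ↦ (p.1 + w, p.2)) ∧ σ.map Prod.fst ≤ γ.map Prod.fst ∧
      σ univ = (1 - θ) * γ univ := by
  set μ := γ.map Prod.fst with hμ
  set f := μ.rnDeriv vol with hf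
  have hfm : Measurable f := Measure.measurable_rnDeriv _ _
  have hμf : vol.withDensity f = μ := Measure.withDensity_rnDeriv_eq _ _ hac
  have hfi : ∫⁻ x, f x ∂vol = γ univ := by
    rw [← setLIntegral_univ, ← withDensity_apply _ MeasurableSet.univ, hμf, hμ,
      Measure.map_apply measurable_fst MeasurableSet.univ, preimage_univ]
  rcases eq_or_ne (γ univ) 0 with h0 | h0
  · exact .of_forall fun w ↦ ⟨0, Measure.zero_le _, by simp [Measure.zero_le], by simp [h0]⟩
  have hlim := tendsto_lintegral_tsub_translate vol hfm (hfi ▸ measure_ne_top γ univ)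
  have hpos : 0 < θ * γ univ := pos_iff_ne_zero.2 (mul_ne_zero hθ h0)
  filter_upwards [hlim.eventually_lt_const hpos] with w hw
  have hT : Measurable fun p : E × Y ↦ (p.1 + w, p.2) := by fun_prop
  set γw := γ.map (fun p ↦ (p.1 + w, p.2)) with hγw
  set μw := γw.map Prod.fst with hμw
  have hμw' : μw = vol.withDensity fun x ↦ f (x - w) := by
    have : μw = μ.map (· + w) := by
      rw [hμw, hγw, hμ, Measure.map_map measurable_fst hT,
        Measure.map_map (by fun_prop) measurable_fst]
      rfl
    rw [this, ← hμf]
    ext s hs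
    have hadd : Measurable fun x : E ↦ x + w := by fun_prop
    rw [Measure.map_apply hadd hs, withDensity_apply _ (hadd hs), withDensity_apply _ hs]
    have := (measurePreserving_add_right vol w).setLIntegral_comp_preimage hs
      (f := fun x ↦ f (x - w)) (by fun_prop)
    simpa using this
  set τ := vol.withDensity fun x ↦ min (f x) (f (x - w)) with hτ
  have hτμ : τ ≤ μ := by
    rw [← hμf]
    exact withDensity_mono (.of_forall fun x ↦ min_le_left _ _)
  have hτμw : τ ≤ μw := by
    rw [hμw']
    exact withDensity_mono (.of_forall fun x ↦ min_le_right _ _)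
  have hτmass : (1 - θ) * γ univ ≤ τ univ := by
    have h1 : γ univ ≤ τ univ + θ * γ univ := by
      calc γ univ = ∫⁻ x, f x ∂vol := hfi.symm
        _ ≤ ∫⁻ x, (min (f x) (f (x - w)) + (f x - f (x - w))) ∂vol := by
            refine lintegral_mono fun x ↦ ?_
            dsimp only
            rcases le_total (f x) (f (x - w)) with h | h
            · simp [h]
            · rw [min_eq_right h, add_tsub_cancel_of_le h]
        _ = τ univ + ∫⁻ x, (f x - f (x - w)) ∂vol := by
            rw [lintegral_add_left (by fun_prop), hτ, withDensity_apply _ MeasurableSet.univ,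
              setLIntegral_univ]
        _ ≤ _ := by gcongr
    rw [ENNReal.sub_mul (by simp), one_mul]
    exact tsub_le_iff_right.2 h1
  have hfw : IsFiniteMeasure γw := Measure.isFiniteMeasure_map _ _
  have hfw' : IsFiniteMeasure μw := Measure.isFiniteMeasure_map _ _
  have hfτ : IsFiniteMeasure τ := isFiniteMeasure_of_le _ hτμw
  set k := τ.rnDeriv μw with hk
  have hkm : Measurable k := Measure.measurable_rnDeriv _ _
  have hk1 : ∀ᵐ x ∂μw, k x ≤ 1 := Measure.rnDeriv_le_one_of_le hτμw
  set σ := γw.withDensity fun p ↦ k p.1 with hσ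
  have hσfst : σ.map Prod.fst = τ := by
    rw [hσ, map_fst_withDensity_comp_fst _ hkm]
    exact Measure.withDensity_rnDeriv_eq _ _ hτμw.absolutelyContinuous
  have hσle : σ ≤ γw := by
    conv_rhs => rw [← withDensity_one (μ := γw)]
    exact withDensity_mono (ae_of_ae_map measurable_fst.aemeasurable hk1)
  have hσuniv : σ univ = τ univ := by
    rw [← hσfst, Measure.map_apply measurable_fst MeasurableSet.univ, preimage_univ]
  set c := (1 - θ) * γ univ / σ univ with hc
  have hc1 : c ≤ 1 := by
    rw [hc, hσuniv]
    exact ENNReal.div_le_of_le_mul (by simpa using hτmass)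
  have hcle : ∀ {Z : Type _} [MeasurableSpace Z] (m : Measure Z), c • m ≤ m := fun m ↦
    Measure.le_iff'.2 fun s ↦ by
      simpa using mul_le_mul_left hc1 (m s)
  refine ⟨c • σ, (hcle σ).trans hσle, ?_, ?_⟩
  · rw [Measure.map_smul, hσfst]
    refine le_trans (Measure.le_iff'.2 fun s ↦ ?_) hτμ
    simpa using mul_le_mul_left hc1 (τ s)
  · rw [Measure.smul_apply, smul_eq_mul]
    refine ENNReal.div_mul_cancel' (fun h ↦ ?_) (fun h ↦ ?_)
    · rw [hσuniv] at h
      simpa [h] using hτmass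
    · exact absurd (hσuniv.symm.trans h) (measure_ne_top τ univ)

end Translation

theorem IsCompact.exists_fin_partition {X : Type*} [PseudoMetricSpace X] [MeasurableSpace X]
    [OpensMeasurableSpace X] {K : Set X} (hK : IsCompact K) {r : ℝ} (hr : 0 < r) :
    ∃ (n : ℕ) (q : Fin n → X) (Q : Fin n → Set X), (∀ i, MeasurableSet (Q i)) ∧
      Pairwise (Function.onFun Disjoint Q) ∧ K ⊆ ⋃ i, Q i ∧ ∀ i, Q i ⊆ Metric.ball (q i) r := by
  obtain ⟨T, -, hTfin, hT⟩ := hK.finite_cover_balls hr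
  obtain ⟨n, q, -, rfl⟩ := hTfin.fin_param
  refine ⟨n, q, disjointed fun i ↦ Metric.ball (q i) r, fun i ↦ ?_, ?_, ?_, disjointed_le _⟩
  · rw [disjointed_apply, Finset.sup_set_eq_biUnion]
    exact Metric.isOpen_ball.measurableSet.diff
      (Finset.measurableSet_biUnion _ fun _ _ ↦ Metric.isOpen_ball.measurableSet)
  · exact disjoint_disjointed _
  · rw [iUnion_disjointed]
    simpa using hT

section Partition

variable {X Y : Type*} [MeasurableSpace X] [MeasurableSpace Y]

theorem sum_restrict_eq_self {ι : Type*} [Countable ι] {Q : ι → Set X}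
    (hQ : ∀ i, MeasurableSet (Q i)) (hd : Pairwise (Function.onFun Disjoint Q)) {μ : Measure X}
    (hcov : μ (⋃ i, Q i)ᶜ = 0) : Measure.sum (fun i ↦ μ.restrict (Q i)) = μ := by
  rw [← Measure.restrict_iUnion hd hQ]
  exact Measure.restrict_eq_self_of_ae_mem (mem_ae_iff.2 hcov)

/-- Redistribution along a plan: given a plan `γ` between `μ` and `ν`, and a measure `A` giving to
each cell `Q i` the mass `θ * μ (Q i)`, there is a plan between `A` and `θ • ν` which, up to
moving points inside the cells, follows `γ`. -/
theorem exists_plan_of_cells {ι : Type*} [Countable ι] {Q : ι → Set X}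
    (hQ : ∀ i, MeasurableSet (Q i)) (hd : Pairwise (Function.onFun Disjoint Q))
    (γ : Measure (X × Y)) [IsFiniteMeasure γ] (A : Measure X) [IsFiniteMeasure A] {θ : ℝ≥0∞}
    (hγcov : γ.map Prod.fst (⋃ i, Q i)ᶜ = 0) (hAcov : A (⋃ i, Q i)ᶜ = 0)
    (hA : ∀ i, A (Q i) = θ * γ.map Prod.fst (Q i))
    {D D' : Set (X × Y)} (hDm : ∀ i, MeasurableSet {y | ∀ x ∈ Q i, (x, y) ∈ D'})
    (hγD : ∀ᵐ p ∂γ, p ∈ D)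
    (hDD' : ∀ i, ∀ x ∈ Q i, ∀ x' ∈ Q i, ∀ y, (x', y) ∈ D → (x, y) ∈ D') :
    ∃ π : Measure (X × Y), π.map Prod.fst = A ∧ π.map Prod.snd = θ • γ.map Prod.snd ∧
      ∀ᵐ p ∂π, p ∈ D' := by
  set G : ι → Measure Y := fun i ↦ (γ.restrict (Prod.fst ⁻¹' Q i)).map Prod.snd with hG
  have hGu : ∀ i, G i univ = γ.map Prod.fst (Q i) := fun i ↦ by
    rw [hG]
    dsimp only
    rw [Measure.map_apply measurable_snd MeasurableSet.univ, preimage_univ,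
      Measure.restrict_apply_univ, Measure.map_apply measurable_fst (hQ i)]
  have hGsum : Measure.sum G = γ.map Prod.snd := by
    rw [hG, ← Measure.map_sum measurable_snd.aemeasurable,
      sum_restrict_eq_self (fun i ↦ measurable_fst (hQ i))]
    · exact fun i j hij ↦ (hd hij).preimage _
    · rw [← preimage_iUnion, ← preimage_compl,
        ← Measure.map_apply measurable_fst (MeasurableSet.iUnion hQ).compl, hγcov]
  have hGfin : ∀ i, IsFiniteMeasure (G i) := fun i ↦ Measure.isFiniteMeasure_map _ _
  refine ⟨Measure.sum fun i ↦ (G i univ)⁻¹ • (A.restrict (Q i)).prod (G i), ?_, ?_, ?_⟩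
  · rw [Measure.map_sum measurable_fst.aemeasurable]
    conv_rhs => rw [← sum_restrict_eq_self hQ hd hAcov]
    congr 1
    ext1 i
    rw [Measure.map_smul, Measure.map_fst_prod, smul_smul]
    rcases eq_or_ne (G i univ) 0 with h0 | h0
    · have : A.restrict (Q i) = 0 := by
        rw [Measure.restrict_eq_zero, hA, ← hGu, h0, mul_zero]
      simp [this]
    · rw [ENNReal.inv_mul_cancel h0 (measure_ne_top _ _), one_smul]
  · rw [Measure.map_sum measurable_snd.aemeasurable, ← hGsum]
    have hsmul : θ • Measure.sum G = Measure.sum fun i ↦ θ • G i := by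
      ext s hs
      simp [Measure.sum_apply _ hs, ENNReal.tsum_mul_left]
    rw [hsmul]
    congr 1
    ext1 i
    rw [Measure.map_smul, Measure.map_snd_prod, smul_smul, Measure.restrict_apply_univ, hA, ← hGu]
    rcases eq_or_ne (G i univ) 0 with h0 | h0
    · simp [Measure.measure_univ_eq_zero.1 h0]
    · rw [mul_comm θ, ← mul_assoc, ENNReal.inv_mul_cancel h0 (measure_ne_top _ _), one_mul]
  · rw [Measure.ae_sum_iff]
    intro i
    refine Measure.ae_smul_measure ?_ _
    have h1 : ∀ᵐ y ∂G i, ∀ x ∈ Q i, (x, y) ∈ D' := by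
      rw [hG, ae_map_iff measurable_snd.aemeasurable (hDm i)]
      filter_upwards [ae_restrict_mem (measurable_fst (hQ i)), ae_restrict_of_ae hγD]
        with p hp hpD x hx
      exact hDD' i x hx p.1 hp p.2 hpD
    have h2 : ∀ᵐ x ∂A.restrict (Q i), x ∈ Q i := ae_restrict_mem (hQ i)
    filter_upwards [Measure.quasiMeasurePreserving_fst.ae h2,
      Measure.quasiMeasurePreserving_snd.ae h1] with p hp1 hp2
    exact hp2 p.1 hp1

end Partition

namespace RelCost

variable {d : ℕ} (R : RelCost d)

theorem zero_mem : (0 : EuclideanSpace ℝ (Fin d)) ∈ R.C :=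
  interior_subset R.zero_mem_interior

theorem h_convex {x y : EuclideanSpace ℝ (Fin d)} (hx : x ∈ R.C) (hy : y ∈ R.C) {a b : ℝ}
    (ha : 0 ≤ a) (hb : 0 ≤ b) (hab : a + b = 1) :
    R.h (a • x + b • y) ≤ ENNReal.ofReal a * R.h x + ENNReal.ofReal b * R.h y := by
  rcases eq_or_ne x y with rfl | hxy
  · rw [← add_smul, ← add_mul, ← ENNReal.ofReal_add ha hb, hab]
    simp
  rcases ha.eq_or_lt with rfl | ha
  · obtain rfl : b = 1 := by linarith
    simp
  rcases hb.eq_or_lt with rfl | hb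
  · obtain rfl : a = 1 := by linarith
    simp
  exact (R.h_strictConvexOn x hx y hy hxy a b ha hb hab).le

theorem inv_smul_add_mem {z u : EuclideanSpace ℝ (Fin d)} {s κ : ℝ} (hs : 0 < s) (hκ : 0 < κ)
    (hz : s⁻¹ • z ∈ R.C) (hu : κ⁻¹ • u ∈ R.C) : (s + κ)⁻¹ • (z + u) ∈ R.C := by
  have h := R.convex hz hu (a := s / (s + κ)) (b := κ / (s + κ)) (by positivity) (by positivity)
    (by field_simp)
  convert h using 1
  rw [smul_smul, smul_smul, smul_add]
  congr 2 <;> field_simp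

theorem h_inv_smul_le {z : EuclideanSpace ℝ (Fin d)} {s t : ℝ} (hs : 0 < s) (hst : s ≤ t) :
    R.h (t⁻¹ • z) ≤ R.h (s⁻¹ • z) := by
  have ht : 0 < t := hs.trans_le hst
  by_cases hz : s⁻¹ • z ∈ R.C
  · have h := R.h_convex hz R.zero_mem (a := s / t) (b := 1 - s / t) (by positivity)
      (sub_nonneg.2 ((div_le_one ht).2 hst)) (by ring)
    rw [smul_zero, add_zero, R.h_zero, mul_zero, add_zero, smul_smul] at h
    have e : s / t * s⁻¹ = t⁻¹ := by field_simp
    rw [e] at h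
    refine h.trans (mul_le_of_le_one_left' ?_)
    exact ENNReal.ofReal_le_one.2 ((div_le_one ht).2 hst)
  · rw [R.h_top _ hz]
    exact le_top

theorem inv_smul_mem_mono {z : EuclideanSpace ℝ (Fin d)} {s t : ℝ} (hs : 0 < s) (hst : s ≤ t)
    (hz : s⁻¹ • z ∈ R.C) : t⁻¹ • z ∈ R.C := by
  have ht : 0 < t := hs.trans_le hst
  have h := R.convex.smul_mem_of_zero_mem R.zero_mem hz (t := s / t)
    ⟨by positivity, (div_le_one ht).2 hst⟩
  rwa [smul_smul, show s / t * s⁻¹ = t⁻¹ by field_simp] at h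

/-- Pulling a displacement `z` inwards by a fraction of a nearby vector `v` allows a shorter time
at almost no extra cost. -/
theorem h_sub_smul_le {M : ℝ≥0∞} (hM : ∀ z ∈ R.C, R.h z ≤ M) {z v : EuclideanSpace ℝ (Fin d)}
    {t η : ℝ} (ht : 0 < t) (hη : 0 < η) (hη1 : η ≤ 1) (hu : (t / 2)⁻¹ • (z - v) ∈ R.C) :
    R.h (((1 - η / 2) * t)⁻¹ • (z - η • v)) ≤ R.h (t⁻¹ • z) + ENNReal.ofReal η * M := by
  by_cases hz : t⁻¹ • z ∈ R.C
  · have hpos : 0 < 1 - η / 2 := by linarith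
    have h := R.h_convex hz hu (a := (1 - η) / (1 - η / 2)) (b := η / 2 / (1 - η / 2))
      (div_nonneg (by linarith) hpos.le) (by positivity)
      (by rw [← add_div, div_eq_one_iff_eq hpos.ne']; ring)
    have e : ((1 - η / 2) * t)⁻¹ • (z - η • v) = ((1 - η) / (1 - η / 2)) • t⁻¹ • z +
        (η / 2 / (1 - η / 2)) • (t / 2)⁻¹ • (z - v) := by
      match_scalars <;> field_simp
      ring
    rw [e]
    refine h.trans (add_le_add (mul_le_of_le_one_left' ?_) (mul_le_mul' ?_ (hM _ hu)))
    · refine ENNReal.ofReal_le_one.2 ((div_le_one hpos).2 (by linarith))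
    · refine ENNReal.ofReal_le_ofReal ((div_le_iff₀ hpos).2 (by nlinarith))
  · rw [R.h_top _ hz, top_add]
    exact le_top

theorem measurableSet_inv_smul_sub_mem (s : ℝ) :
    MeasurableSet {p : EuclideanSpace ℝ (Fin d) × EuclideanSpace ℝ (Fin d) |
      s⁻¹ • (p.2 - p.1) ∈ R.C} :=
  (R.isClosed.preimage (by fun_prop : Continuous fun
    p : EuclideanSpace ℝ (Fin d) × EuclideanSpace ℝ (Fin d) ↦ s⁻¹ • (p.2 - p.1))).measurableSet

theorem ae_mem_of_transportCost_ne_top {s : ℝ}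
    {γ : Measure (EuclideanSpace ℝ (Fin d) × EuclideanSpace ℝ (Fin d))}
    (hγ : transportCost R s γ ≠ ⊤) : ∀ᵐ p ∂γ, s⁻¹ • (p.2 - p.1) ∈ R.C := by
  have hm := (R.measurableSet_inv_smul_sub_mem s).compl
  by_contra hne
  refine hγ (top_unique ?_)
  calc ⊤ = ∫⁻ _ in {p | s⁻¹ • (p.2 - p.1) ∈ R.C}ᶜ, ⊤ ∂γ := by
        rw [setLIntegral_const, ENNReal.top_mul]
        exact fun h ↦ hne (mem_ae_iff.2 h)
    _ ≤ ∫⁻ p in {p | s⁻¹ • (p.2 - p.1) ∈ R.C}ᶜ, R.h (s⁻¹ • (p.2 - p.1)) ∂γ :=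
        setLIntegral_mono' hm fun p hp ↦ (R.h_top _ hp).ge
    _ ≤ transportCost R s γ := setLIntegral_le_lintegral _ _

theorem transportCost_le_mul {M : ℝ≥0∞} (hM : ∀ z ∈ R.C, R.h z ≤ M) {s : ℝ}
    {γ : Measure (EuclideanSpace ℝ (Fin d) × EuclideanSpace ℝ (Fin d))}
    (hγ : ∀ᵐ p ∂γ, s⁻¹ • (p.2 - p.1) ∈ R.C) : transportCost R s γ ≤ M * γ univ := by
  rw [← lintegral_const]
  exact lintegral_mono_ae (hγ.mono fun p hp ↦ hM _ hp)

end RelCost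

theorem minCost_anti {d : ℕ} (R : RelCost d) (μ ν : Measure (EuclideanSpace ℝ (Fin d))) {s t : ℝ}
    (hs : 0 < s) (hst : s ≤ t) : minCost R μ ν t ≤ minCost R μ ν s :=
  iInf₂_mono fun _ _ ↦ lintegral_mono fun _ ↦ R.h_inv_smul_le hs hst

/-- A sub-plan keeping the proportion `1 - θ` of the mass of each cell can be completed, following
a plan `γ₀` of finite cost at an earlier time, into a plan of cost larger by at most `2 * θ * M`. -/
theorem minCost_le_of_subplan {d : ℕ} (R : RelCost d)
    {μ ν : Measure (EuclideanSpace ℝ (Fin d))} [IsProbabilityMeasure μ] [IsProbabilityMeasure ν]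
    {M θ : ℝ≥0∞} (hM : ∀ z ∈ R.C, R.h z ≤ M) (hθ1 : θ ≤ 1) {ι : Type*} [Countable ι]
    {Q : ι → Set (EuclideanSpace ℝ (Fin d))} (hQ : ∀ i, MeasurableSet (Q i))
    (hd : Pairwise (Function.onFun Disjoint Q))
    (hμcov : μ (⋃ i, Q i)ᶜ = 0) (hνcov : ν (⋃ i, Q i)ᶜ = 0)
    {s₀ κ s : ℝ} (hs₀ : 0 < s₀) (hκ : 0 < κ) (hs : s₀ + κ ≤ s)
    (hκQ : ∀ i, ∀ x ∈ Q i, ∀ y ∈ Q i, κ⁻¹ • (y - x) ∈ R.C)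
    {γ₀ : Measure (EuclideanSpace ℝ (Fin d) × EuclideanSpace ℝ (Fin d))}
    (hγ₀ : γ₀ ∈ Plans μ ν) (hγ₀s : transportCost R s₀ γ₀ ≠ ⊤)
    {S : Measure (EuclideanSpace ℝ (Fin d) × EuclideanSpace ℝ (Fin d))}
    (hSfst : S.map Prod.fst ≤ μ) (hSsnd : S.map Prod.snd ≤ ν)
    (hSμ : ∀ i, S.map Prod.fst (Q i) = (1 - θ) * μ (Q i))
    (hSν : ∀ i, S.map Prod.snd (Q i) = (1 - θ) * ν (Q i)) :
    minCost R μ ν s ≤ transportCost R s S + 2 * θ * M := by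
  obtain ⟨hγ₀p, hγ₀fst, hγ₀snd⟩ := hγ₀
  have hθtop : θ ≠ ⊤ := (hθ1.trans_lt ENNReal.one_lt_top).ne
  have hs₀κ : 0 < s₀ + κ := by positivity
  have hγ₀ae := R.ae_mem_of_transportCost_ne_top hγ₀s
  have hmass : ∀ m₁ m₂ : Measure (EuclideanSpace ℝ (Fin d)), IsFiniteMeasure m₁ → m₂ ≤ m₁ →
      ∀ s, MeasurableSet s → m₂ s = (1 - θ) * m₁ s → (m₁ - m₂) s = θ * m₁ s := by
    intro m₁ m₂ h₁ hle s hsm h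
    have h₂ : IsFiniteMeasure m₂ := isFiniteMeasure_of_le _ hle
    have hadd : (m₁ - m₂) s + m₂ s = m₁ s := by
      rw [← Measure.add_apply, Measure.sub_add_cancel_of_le hle]
    refine (ENNReal.add_left_inj (measure_ne_top m₂ s)).1 ?_
    rw [hadd, h, ← add_mul, add_tsub_cancel_of_le hθ1, one_mul]
  have hSf : IsFiniteMeasure (S.map Prod.fst) := isFiniteMeasure_of_le _ hSfst
  have hSf' : IsFiniteMeasure (S.map Prod.snd) := isFiniteMeasure_of_le _ hSsnd
  obtain ⟨π₁, hπ₁fst, hπ₁snd, hπ₁⟩ := exists_plan_of_cells hQ hd γ₀ (μ - S.map Prod.fst) (θ := θ)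
    (by rw [hγ₀fst, hμcov]) (Measure.absolutelyContinuous_of_le Measure.sub_le hμcov)
    (fun i ↦ by rw [hγ₀fst]; exact hmass _ _ inferInstance hSfst _ (hQ i) (hSμ i))
    (D := {p | s₀⁻¹ • (p.2 - p.1) ∈ R.C}) (D' := {p | (s₀ + κ)⁻¹ • (p.2 - p.1) ∈ R.C})
    (fun i ↦ by
      simp only [mem_ofPred_eq, ofPred_forall]
      exact (isClosed_biInter fun x _ ↦ R.isClosed.preimage (by fun_prop :
        Continuous fun y : EuclideanSpace ℝ (Fin d) ↦ (s₀ + κ)⁻¹ • (y - x))).measurableSet)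
    hγ₀ae
    (fun i x hx x' hx' y hy ↦ by
      have := R.inv_smul_add_mem hs₀ hκ hy (hκQ i x hx x' hx')
      simpa using this)
  have hswap : Measurable (Prod.swap : EuclideanSpace ℝ (Fin d) × EuclideanSpace ℝ (Fin d) → _) :=
    measurable_swap
  have hmapswap : ∀ m : Measure (EuclideanSpace ℝ (Fin d) × EuclideanSpace ℝ (Fin d)),
      (m.map Prod.swap).map Prod.fst = m.map Prod.snd ∧
      (m.map Prod.swap).map Prod.snd = m.map Prod.fst := fun m ↦ by
    rw [Measure.map_map measurable_fst hswap, Measure.map_map measurable_snd hswap]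
    exact ⟨rfl, rfl⟩
  have hγ₀f : IsFiniteMeasure (γ₀.map Prod.swap) := Measure.isFiniteMeasure_map _ _
  obtain ⟨π₂, hπ₂fst, hπ₂snd, hπ₂⟩ := exists_plan_of_cells hQ hd (γ₀.map Prod.swap)
    (ν - S.map Prod.snd) (θ := θ)
    (by rw [(hmapswap _).1, hγ₀snd, hνcov])
    (Measure.absolutelyContinuous_of_le Measure.sub_le hνcov)
    (fun i ↦ by rw [(hmapswap _).1, hγ₀snd]; exact hmass _ _ inferInstance hSsnd _ (hQ i) (hSν i))
    (D := {p | s₀⁻¹ • (p.1 - p.2) ∈ R.C}) (D' := {p | (s₀ + κ)⁻¹ • (p.1 - p.2) ∈ R.C})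
    (fun i ↦ by
      simp only [mem_ofPred_eq, ofPred_forall]
      exact (isClosed_biInter fun x _ ↦ R.isClosed.preimage (by fun_prop :
        Continuous fun y : EuclideanSpace ℝ (Fin d) ↦ (s₀ + κ)⁻¹ • (x - y))).measurableSet)
    ((ae_map_iff (p := fun p ↦ s₀⁻¹ • (p.1 - p.2) ∈ R.C) hswap.aemeasurable
      (hswap (R.measurableSet_inv_smul_sub_mem s₀))).2 hγ₀ae)
    (fun i x hx x' hx' y hy ↦ by
      have := R.inv_smul_add_mem hs₀ hκ hy (hκQ i x' hx' x hx)
      simpa using this)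
  rw [(hmapswap _).2, hγ₀fst] at hπ₂snd
  rw [hγ₀snd] at hπ₁snd
  have hπ₂ae : ∀ᵐ p ∂π₂.map Prod.swap, s⁻¹ • (p.2 - p.1) ∈ R.C := by
    rw [ae_map_iff hswap.aemeasurable (R.measurableSet_inv_smul_sub_mem s)]
    exact hπ₂.mono fun p hp ↦ R.inv_smul_mem_mono hs₀κ hs hp
  have hπ₁ae : ∀ᵐ p ∂π₁, s⁻¹ • (p.2 - p.1) ∈ R.C :=
    hπ₁.mono fun p hp ↦ R.inv_smul_mem_mono hs₀κ hs hp
  have hπ₁u : π₁ univ = θ := by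
    have : π₁.map Prod.snd univ = θ := by rw [hπ₁snd]; simp
    rwa [Measure.map_apply measurable_snd MeasurableSet.univ, preimage_univ] at this
  have hπ₂u : π₂.map Prod.swap univ = θ := by
    have : π₂.map Prod.snd univ = θ := by rw [hπ₂snd]; simp
    rwa [Measure.map_apply measurable_snd MeasurableSet.univ, preimage_univ,
      ← preimage_univ (f := Prod.swap), ← Measure.map_apply hswap MeasurableSet.univ] at this
  have hscale : ∀ m : Measure (EuclideanSpace ℝ (Fin d)), (1 + θ)⁻¹ • (m + θ • m) = m := fun m ↦ by
    nth_rewrite 1 [← one_smul ℝ≥0∞ m]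
    rw [← add_smul, smul_smul, ENNReal.inv_mul_cancel (by simp) (by simp [hθtop]), one_smul]
  set P := (1 + θ)⁻¹ • (S + π₁ + π₂.map Prod.swap) with hP
  have hPfst : P.map Prod.fst = μ := by
    rw [hP, Measure.map_smul, Measure.map_add _ _ measurable_fst, Measure.map_add _ _ measurable_fst,
      (hmapswap _).1, hπ₂snd, hπ₁fst, add_comm (S.map _), Measure.sub_add_cancel_of_le hSfst,
      hscale]
  have hPsnd : P.map Prod.snd = ν := by
    rw [hP, Measure.map_smul, Measure.map_add _ _ measurable_snd, Measure.map_add _ _ measurable_snd,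
      (hmapswap _).2, hπ₂fst, hπ₁snd, add_right_comm, add_comm (S.map _),
      Measure.sub_add_cancel_of_le hSsnd, hscale]
  have hPp : IsProbabilityMeasure P := by
    constructor
    rw [← preimage_univ (f := Prod.fst), ← Measure.map_apply measurable_fst MeasurableSet.univ,
      hPfst, measure_univ]
  calc minCost R μ ν s ≤ transportCost R s P := iInf₂_le P ⟨hPp, hPfst, hPsnd⟩
    _ ≤ transportCost R s S + transportCost R s π₁ + transportCost R s (π₂.map Prod.swap) := by
        rw [transportCost, hP, lintegral_smul_measure, lintegral_add_measure,
          lintegral_add_measure]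
        exact mul_le_of_le_one_left' (ENNReal.inv_le_one.2 le_self_add)
    _ ≤ transportCost R s S + M * θ + M * θ := by
        gcongr
        · exact hπ₁u ▸ R.transportCost_le_mul hM hπ₁ae
        · conv_rhs => rw [← hπ₂u]
          exact R.transportCost_le_mul hM hπ₂ae
    _ = _ := by ring

theorem measure_eq_mul_of_le_of_null_compl {X : Type*} [MeasurableSpace X] {m m' : Measure X}
    {c : ℝ≥0∞} (hle : m' ≤ m) (hu : m' univ = c * m univ) {s t : Set X} (hs : m sᶜ = 0)
    (hst : s ⊆ t ∨ Disjoint t s) : m' t = c * m t := by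
  rcases hst with h | h
  · have ht : m tᶜ = 0 := measure_mono_null (compl_subset_compl.2 h) hs
    have ht' : m' tᶜ = 0 := Measure.absolutelyContinuous_of_le hle ht
    rw [measure_congr (ae_eq_univ.2 ht), measure_congr (ae_eq_univ.2 ht'), hu]
  · have ht : m t = 0 := measure_mono_null h.subset_compl_right hs
    rw [ht, Measure.absolutelyContinuous_of_le hle ht, mul_zero]

theorem eventually_minCost_le {d : ℕ} (R : RelCost d)
    {μ ν : Measure (EuclideanSpace ℝ (Fin d))} [IsProbabilityMeasure μ] [IsProbabilityMeasure ν]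
    (hμsupp : ∃ K, IsCompact K ∧ μ Kᶜ = 0) (hνsupp : ∃ K, IsCompact K ∧ ν Kᶜ = 0)
    (hac : μ ≪ volume) {M θ : ℝ≥0∞} (hM : ∀ z ∈ R.C, R.h z ≤ M) (hθ : θ ≠ 0) (hθ1 : θ ≤ 1)
    {s₀ t : ℝ} (hs₀ : 0 < s₀) (hst : s₀ < t)
    {γ₀ : Measure (EuclideanSpace ℝ (Fin d) × EuclideanSpace ℝ (Fin d))}
    (hγ₀ : γ₀ ∈ Plans μ ν) (hγ₀s : transportCost R s₀ γ₀ ≠ ⊤)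
    {γ : Measure (EuclideanSpace ℝ (Fin d) × EuclideanSpace ℝ (Fin d))} (hγ : γ ∈ Plans μ ν) :
    ∀ᶠ η in 𝓝[>] (0 : ℝ), minCost R μ ν ((1 - η / 2) * t) ≤
      transportCost R t γ + ENNReal.ofReal η * M + 2 * θ * M := by
  have ht : 0 < t := hs₀.trans hst
  obtain ⟨hγp, hγfst, hγsnd⟩ := hγ
  obtain ⟨ρ, hρ, hball⟩ := Metric.mem_nhds_iff.1 (mem_interior_iff_mem_nhds.1 R.zero_mem_interior)
  set κ := (t - s₀) / 2 with hκdef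
  have hκ : 0 < κ := by rw [hκdef]; linarith
  have hκt : κ ≤ t / 2 := by rw [hκdef]; linarith
  have hsmall : ∀ u : EuclideanSpace ℝ (Fin d), ‖u‖ < ρ * κ → κ⁻¹ • u ∈ R.C := fun u hu ↦ by
    refine hball (mem_ball_zero_iff.2 ?_)
    rw [norm_smul, norm_inv, Real.norm_of_nonneg hκ.le, inv_mul_lt_iff₀ hκ, mul_comm]
    exact hu
  obtain ⟨K₁, hK₁, hμK⟩ := hμsupp
  obtain ⟨K₂, hK₂, hνK⟩ := hνsupp
  obtain ⟨n, q, Q, hQ, hd, hcov, hQball⟩ :=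
    (hK₁.union hK₂).exists_fin_partition (r := ρ * κ / 2) (by positivity)
  have hμcov : μ (⋃ i, Q i)ᶜ = 0 :=
    measure_mono_null (compl_subset_compl.2 (subset_union_left.trans hcov)) hμK
  have hνcov : ν (⋃ i, Q i)ᶜ = 0 :=
    measure_mono_null (compl_subset_compl.2 (subset_union_right.trans hcov)) hνK
  have hdist : ∀ i, ∀ x ∈ Q i, ‖x - q i‖ < ρ * κ / 2 := fun i x hx ↦
    mem_ball_iff_norm.1 (hQball i hx)
  have hκQ : ∀ i, ∀ x ∈ Q i, ∀ y ∈ Q i, κ⁻¹ • (y - x) ∈ R.C := fun i x hx y hy ↦ by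
    refine hsmall _ ?_
    have h := norm_sub_le (y - q i) (x - q i)
    rw [sub_sub_sub_cancel_right] at h
    linarith [hdist i x hx, hdist i y hy]
  set Q2 : Fin n × Fin n → Set (EuclideanSpace ℝ (Fin d) × EuclideanSpace ℝ (Fin d)) :=
    fun i ↦ Q i.1 ×ˢ Q i.2 with hQ2
  have hQ2m : ∀ i, MeasurableSet (Q2 i) := fun i ↦ (hQ _).prod (hQ _)
  have hQ2sum : Measure.sum (fun i ↦ γ.restrict (Q2 i)) = γ := by
    refine sum_restrict_eq_self hQ2m (fun i j hij ↦ ?_) ?_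
    · refine Set.disjoint_prod.2 ?_
      by_cases h : i.1 = j.1
      · exact .inr (hd fun h' ↦ hij (Prod.ext h h'))
      · exact .inl (hd h)
    · have h1 : ∀ᵐ p ∂γ, p.1 ∈ ⋃ i, Q i :=
        ae_of_ae_map measurable_fst.aemeasurable (hγfst ▸ mem_ae_iff.2 hμcov)
      have h2 : ∀ᵐ p ∂γ, p.2 ∈ ⋃ i, Q i :=
        ae_of_ae_map measurable_snd.aemeasurable (hγsnd ▸ mem_ae_iff.2 hνcov)
      refine mem_ae_iff.1 ?_
      filter_upwards [h1, h2] with p hp1 hp2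
      obtain ⟨i, hi⟩ := mem_iUnion.1 hp1
      obtain ⟨j, hj⟩ := mem_iUnion.1 hp2
      exact mem_iUnion.2 ⟨(i, j), hi, hj⟩
  have hkeep : ∀ i : Fin n × Fin n, ∀ᶠ η in 𝓝[>] (0 : ℝ),
      ∃ σ : Measure (EuclideanSpace ℝ (Fin d) × EuclideanSpace ℝ (Fin d)),
        σ ≤ (γ.restrict (Q2 i)).map (fun p ↦ (p.1 + η • (q i.2 - q i.1), p.2)) ∧
        σ.map Prod.fst ≤ (γ.restrict (Q2 i)).map Prod.fst ∧
        σ univ = (1 - θ) * γ.restrict (Q2 i) univ := fun i ↦ by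
    have hlim : Tendsto (fun η : ℝ ↦ η • (q i.2 - q i.1)) (𝓝[>] 0) (𝓝 0) := by
      have : Tendsto (fun η : ℝ ↦ η • (q i.2 - q i.1)) (𝓝 0) (𝓝 ((0 : ℝ) • (q i.2 - q i.1))) :=
        (Continuous.tendsto (by fun_prop) 0)
      rw [zero_smul] at this
      exact this.mono_left nhdsWithin_le_nhds
    refine hlim.eventually (eventually_exists_le_map_translate_fst volume _ ?_ hθ)
    refine (Measure.absolutelyContinuous_of_le ?_).trans (hγfst ▸ hac)
    exact Measure.map_mono Measure.restrict_le_self measurable_fst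
  have hη1 : ∀ᶠ η in 𝓝[>] (0 : ℝ), η < 1 := nhdsWithin_le_nhds (Iio_mem_nhds one_pos)
  have hηκ : ∀ᶠ η in 𝓝[>] (0 : ℝ), η < 2 * κ / t :=
    nhdsWithin_le_nhds (Iio_mem_nhds (by positivity))
  filter_upwards [eventually_all.2 hkeep, hη1, hηκ, self_mem_nhdsWithin] with η hη hη1 hηκ hη0
  choose σ hσle hσfst hσu using hη
  have hη0 : 0 < η := hη0
  have hσsnd : ∀ i, (σ i).map Prod.snd ≤ (γ.restrict (Q2 i)).map Prod.snd := fun i ↦ by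
    refine (Measure.map_mono (hσle i) measurable_snd).trans (le_of_eq ?_)
    rw [Measure.map_map measurable_snd (by fun_prop)]
    rfl
  have hγfst' : Measure.sum (fun i ↦ (γ.restrict (Q2 i)).map Prod.fst) = μ := by
    rw [← Measure.map_sum measurable_fst.aemeasurable, hQ2sum, hγfst]
  have hγsnd' : Measure.sum (fun i ↦ (γ.restrict (Q2 i)).map Prod.snd) = ν := by
    rw [← Measure.map_sum measurable_snd.aemeasurable, hQ2sum, hγsnd]
  have hsubset : ∀ i l : Fin n, Q i ⊆ Q l ∨ Disjoint (Q l) (Q i) := fun i l ↦ by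
    by_cases h : l = i
    · exact .inl (h ▸ Subset.rfl)
    · exact .inr (hd h)
  set S := Measure.sum σ with hS
  refine (minCost_le_of_subplan (s := (1 - η / 2) * t) (S := S) R hM hθ1 hQ hd hμcov hνcov hs₀ hκ
    ?_ hκQ hγ₀ hγ₀s ?_ ?_ ?_ ?_).trans (add_le_add_left ?_ _)
  · rw [lt_div_iff₀ ht] at hηκ
    linarith
  · rw [hS, Measure.map_sum measurable_fst.aemeasurable, ← hγfst']
    exact Measure.le_iff.2 fun s hs ↦ by
      rw [Measure.sum_apply _ hs, Measure.sum_apply _ hs]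
      exact ENNReal.tsum_le_tsum fun i ↦ hσfst i s
  · rw [hS, Measure.map_sum measurable_snd.aemeasurable, ← hγsnd']
    exact Measure.le_iff.2 fun s hs ↦ by
      rw [Measure.sum_apply _ hs, Measure.sum_apply _ hs]
      exact ENNReal.tsum_le_tsum fun i ↦ hσsnd i s
  · intro l
    rw [hS, Measure.map_sum measurable_fst.aemeasurable, Measure.sum_apply _ (hQ l)]
    conv_rhs => rw [← hγfst', Measure.sum_apply _ (hQ l), ← ENNReal.tsum_mul_left]
    refine tsum_congr fun i ↦ measure_eq_mul_of_le_of_null_compl (hσfst i) ?_ ?_ (hsubset i.1 l)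
    · rw [Measure.map_apply measurable_fst MeasurableSet.univ,
        Measure.map_apply measurable_fst MeasurableSet.univ, preimage_univ, hσu]
    · rw [Measure.map_apply measurable_fst (hQ _).compl]
      exact mem_ae_iff.1 ((ae_restrict_mem (hQ2m i)).mono fun p hp ↦ hp.1)
  · intro l
    rw [hS, Measure.map_sum measurable_snd.aemeasurable, Measure.sum_apply _ (hQ l)]
    conv_rhs => rw [← hγsnd', Measure.sum_apply _ (hQ l), ← ENNReal.tsum_mul_left]
    refine tsum_congr fun i ↦ measure_eq_mul_of_le_of_null_compl (hσsnd i) ?_ ?_ (hsubset i.2 l)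
    · rw [Measure.map_apply measurable_snd MeasurableSet.univ,
        Measure.map_apply measurable_snd MeasurableSet.univ, preimage_univ, hσu]
    · rw [Measure.map_apply measurable_snd (hQ _).compl]
      exact mem_ae_iff.1 ((ae_restrict_mem (hQ2m i)).mono fun p hp ↦ hp.2)
  · have hpiece : ∀ i, transportCost R ((1 - η / 2) * t) (σ i) ≤
        ∫⁻ p, (R.h (t⁻¹ • (p.2 - p.1)) + ENNReal.ofReal η * M) ∂γ.restrict (Q2 i) := fun i ↦ by
      refine (lintegral_mono' (hσle i) le_rfl).trans ((lintegral_map_le _ _).trans ?_)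
      refine lintegral_mono_ae ?_
      filter_upwards [ae_restrict_mem (hQ2m i)] with p hp
      have hu : (t / 2)⁻¹ • ((p.2 - p.1) - (q i.2 - q i.1)) ∈ R.C := by
        refine R.inv_smul_mem_mono hκ hκt (hsmall _ ?_)
        have h := norm_sub_le (p.2 - q i.2) (p.1 - q i.1)
        rw [sub_sub_sub_comm] at h
        linarith [hdist _ _ hp.1, hdist _ _ hp.2]
      have h := R.h_sub_smul_le hM ht hη0 hη1.le hu
      rwa [← sub_sub]
    calc transportCost R ((1 - η / 2) * t) S
        = ∑' i, transportCost R ((1 - η / 2) * t) (σ i) := lintegral_sum_measure _ _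
      _ ≤ ∑' i, ∫⁻ p, (R.h (t⁻¹ • (p.2 - p.1)) + ENNReal.ofReal η * M) ∂γ.restrict (Q2 i) :=
          ENNReal.tsum_le_tsum hpiece
      _ = ∫⁻ p, (R.h (t⁻¹ • (p.2 - p.1)) + ENNReal.ofReal η * M) ∂γ := by
          rw [← lintegral_sum_measure, hQ2sum]
      _ = transportCost R t γ + ENNReal.ofReal η * M := by
          rw [lintegral_add_right _ measurable_const, lintegral_const, measure_univ, mul_one]
          rfl

/-- Left-continuity of the total cost at supercritical times: for every `t > T`,
`C(s) → C(t)` as `s ↗ t`. -/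
theorem minCost_left_continuous {d : ℕ} (R : RelCost d)
    (μ ν : Measure (EuclideanSpace ℝ (Fin d)))
    [IsProbabilityMeasure μ] [IsProbabilityMeasure ν] (hμν : μ ≠ ν)
    (hμsupp : ∃ K, IsCompact K ∧ μ Kᶜ = 0)
    (hνsupp : ∃ K, IsCompact K ∧ ν Kᶜ = 0)
    (hac : μ ≪ volume)
    (t : ℝ) (ht : criticalTime R μ ν < t) :
    Tendsto (minCost R μ ν) (𝓝[<] t) (𝓝 (minCost R μ ν t)) := by
  have ht0 : 0 < t := (Real.sInf_nonneg fun s hs ↦ hs.1.le).trans_lt ht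
  have hpos : ∀ᶠ s in 𝓝[<] t, 0 < s := nhdsWithin_le_nhds (Ioi_mem_nhds ht0)
  rcases eq_empty_or_nonempty {t : ℝ | 0 < t ∧ minCost R μ ν t ≠ ⊤} with hem | hne
  · have htop : ∀ s, 0 < s → minCost R μ ν s = ⊤ := fun s hs ↦ by
      by_contra h
      exact (hem ▸ (⟨hs, h⟩ : s ∈ {t : ℝ | 0 < t ∧ minCost R μ ν t ≠ ⊤}) : s ∈ (∅ : Set ℝ))
    rw [htop t ht0]
    exact tendsto_const_nhds.congr' (hpos.mono fun s hs ↦ (htop s hs).symm)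
  obtain ⟨s₀, ⟨hs₀, hs₀fin⟩, hs₀t⟩ := exists_lt_of_csInf_lt hne ht
  obtain ⟨γ₀, hγ₀, hγ₀s⟩ : ∃ γ₀ ∈ Plans μ ν, transportCost R s₀ γ₀ < ⊤ := by
    simpa [minCost, iInf_lt_iff] using hs₀fin.lt_top
  obtain ⟨M, hMtop, hM⟩ := R.h_bddOn
  refine tendsto_order.2 ⟨fun a ha ↦ ?_, fun b hb ↦ ?_⟩
  · filter_upwards [hpos, self_mem_nhdsWithin] with s hs hst
    exact ha.trans_le (minCost_anti R μ ν hs (le_of_lt hst))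
  obtain ⟨γ, hγ, hγb⟩ : ∃ γ ∈ Plans μ ν, transportCost R t γ < b := by
    simpa [minCost, iInf_lt_iff] using hb
  have hlim : Tendsto (fun x : ℝ ↦ transportCost R t γ + ENNReal.ofReal x * M +
      2 * ENNReal.ofReal x * M) (𝓝[>] 0) (𝓝 (transportCost R t γ)) := by
    have h : Tendsto (fun x : ℝ ↦ ENNReal.ofReal x) (𝓝[>] 0) (𝓝 0) := by
      have := ENNReal.continuous_ofReal.tendsto 0
      rw [ENNReal.ofReal_zero] at this
      exact this.mono_left nhdsWithin_le_nhds
    have h1 := ENNReal.Tendsto.mul_const h (.inr hMtop)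
    have h2 := ENNReal.Tendsto.mul_const
      (ENNReal.Tendsto.const_mul h (.inr ENNReal.ofNat_ne_top) (a := 2)) (.inr hMtop)
    simpa using (tendsto_const_nhds.add h1).add h2
  have hlt1 : ∀ᶠ x in 𝓝[>] (0 : ℝ), x < 1 := nhdsWithin_le_nhds (Iio_mem_nhds one_pos)
  obtain ⟨x, hxb, hx1, hx0⟩ := ((hlim.eventually_lt_const hγb).and
    (hlt1.and self_mem_nhdsWithin)).exists
  have hx0 : 0 < x := hx0
  have hmain := eventually_minCost_le R hμsupp hνsupp hac hM
    (ENNReal.ofReal_pos.2 hx0).ne' (ENNReal.ofReal_le_one.2 hx1.le) hs₀ hs₀t hγ₀ hγ₀s.ne hγ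
  have hηlim : Tendsto (fun s : ℝ ↦ 2 * (1 - s / t)) (𝓝[<] t) (𝓝[>] 0) := by
    refine tendsto_nhdsWithin_iff.2 ⟨?_, ?_⟩
    · have : Tendsto (fun s : ℝ ↦ 2 * (1 - s / t)) (𝓝 t) (𝓝 (2 * (1 - t / t))) :=
        Continuous.tendsto (by fun_prop) t
      rw [div_self ht0.ne', sub_self, mul_zero] at this
      exact this.mono_left nhdsWithin_le_nhds
    · filter_upwards [self_mem_nhdsWithin] with s hs
      have : s / t < 1 := (div_lt_one ht0).2 hs
      exact mem_Ioi.2 (by linarith)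
  have hxlt : ∀ᶠ η in 𝓝[>] (0 : ℝ), η < x := nhdsWithin_le_nhds (Iio_mem_nhds hx0)
  filter_upwards [hηlim.eventually hmain, hηlim.eventually hxlt] with s hs hsx
  have e : (1 - 2 * (1 - s / t) / 2) * t = s := by field_simp; ring
  rw [e] at hs
  refine hs.trans_lt (lt_of_le_of_lt ?_ hxb)
  gcongr
end
end

section
/- Let μ, ν be probability measures on ℝ^d (more generally on Polish spaces X and Y) and let c : ℝ^d × ℝ^d → [0,+∞] be lower semicontinuous. Then the infimum inf{∬ c(x,y) dγ(x,y) : γ ∈ Π(μ,ν)} is attained: there exists an optimal transport plan γ ∈ Π(μ,ν) whose cost equals this infimum. -/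
open MeasureTheory Set Filter Topology
open scoped ENNReal

/-- The integral of a bounded lower semicontinuous function satisfies the liminf inequality along
weakly convergent sequences of probability measures. -/
theorem LowerSemicontinuous.lintegral_le_liminf_of_tendsto {Z : Type*} [TopologicalSpace Z]
    [MeasurableSpace Z] [OpensMeasurableSpace Z] [HasOuterApproxClosed Z]
    {f : Z → ℝ≥0∞} (hf : LowerSemicontinuous f) {B : ℝ≥0∞} (hB : B ≠ ∞) (hfB : ∀ z, f z ≤ B)
    {γ : ProbabilityMeasure Z} {γs : ℕ → ProbabilityMeasure Z}
    (h : Tendsto γs atTop (𝓝 γ)) :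
    ∫⁻ z, f z ∂(γ : Measure Z) ≤
      atTop.liminf fun n ↦ ∫⁻ z, f z ∂(γs n : Measure Z) := by
  have hfin : ∀ z, f z ≠ ∞ := fun z ↦ ne_top_of_le_ne_top hB (hfB z)
  have layer : ∀ ρ : Measure Z,
      ∫⁻ z, f z ∂ρ = ∫⁻ t in Ioi (0 : ℝ), ρ {z | t < (f z).toReal} := fun ρ ↦ by
    rw [← lintegral_eq_lintegral_meas_lt ρ (Eventually.of_forall fun _ ↦ ENNReal.toReal_nonneg)
      hf.measurable.ennreal_toReal.aemeasurable]
    simp [ENNReal.ofReal_toReal (hfin _)]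
  have hopen : ∀ t ∈ Ioi (0 : ℝ), IsOpen {z | t < (f z).toReal} := fun t ht ↦ by
    convert! hf.isOpen_preimage (ENNReal.ofReal t) using 1
    ext z
    simp [ENNReal.ofReal_lt_iff_lt_toReal (le_of_lt ht) (hfin z)]
  simp_rw [layer]
  refine (setLIntegral_mono' measurableSet_Ioi fun t ht ↦
    ProbabilityMeasure.le_liminf_measure_open_of_tendsto h (hopen t ht)).trans ?_
  exact lintegral_liminf_le fun n ↦ Antitone.measurable fun s t hst ↦
    measure_mono fun z hz ↦ lt_of_le_of_lt hst hz

/-- Integration of a lower semicontinuous function is lower semicontinuous for the topology of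
weak convergence of probability measures. -/
theorem LowerSemicontinuous.lowerSemicontinuous_lintegral {Z : Type*} [TopologicalSpace Z]
    [TopologicalSpace.PseudoMetrizableSpace Z] [TopologicalSpace.SeparableSpace Z]
    [MeasurableSpace Z] [BorelSpace Z] {f : Z → ℝ≥0∞} (hf : LowerSemicontinuous f) :
    LowerSemicontinuous fun γ : ProbabilityMeasure Z ↦ ∫⁻ z, f z ∂(γ : Measure Z) := by
  have hmin : ∀ n : ℕ, LowerSemicontinuous fun z ↦ min (f z) n :=
    fun n ↦ hf.inf lowerSemicontinuous_const
  have hsup : ∀ z, f z = ⨆ n : ℕ, min (f z) n := fun z ↦ by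
    rw [← inf_iSup_eq, ENNReal.iSup_natCast, inf_top_eq]
  have hint : ∀ γ : ProbabilityMeasure Z, ∫⁻ z, f z ∂(γ : Measure Z) =
      ⨆ n : ℕ, ∫⁻ z, min (f z) n ∂(γ : Measure Z) := fun γ ↦ by
    rw [← lintegral_iSup (fun n ↦ (hmin n).measurable)
      fun m n hmn z ↦ min_le_min_left _ (by exact_mod_cast hmn)]
    exact lintegral_congr hsup
  simp_rw [hint]
  refine lowerSemicontinuous_iSup fun n ↦ lowerSemicontinuous_iff_isClosed_preimage.2 fun a ↦ ?_
  refine IsSeqClosed.isClosed fun γs γ hγs hγ ↦ ?_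
  refine ((hmin n).lintegral_le_liminf_of_tendsto (ENNReal.natCast_ne_top n)
    (fun z ↦ min_le_right _ _) hγ).trans ?_
  exact (liminf_le_liminf (Eventually.of_forall hγs)).trans_eq (liminf_const a)

/-- The set of probability measures on a product with prescribed marginals is compact for the
topology of weak convergence. -/
theorem isCompact_setOf_map_fst_eq_map_snd_eq {X Y : Type*}
    [MeasurableSpace X] [TopologicalSpace X] [PolishSpace X] [BorelSpace X]
    [MeasurableSpace Y] [TopologicalSpace Y] [PolishSpace Y] [BorelSpace Y]
    (μ : ProbabilityMeasure X) (ν : ProbabilityMeasure Y) :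
    IsCompact {γ : ProbabilityMeasure (X × Y) |
      γ.map measurable_fst.aemeasurable = μ ∧ γ.map measurable_snd.aemeasurable = ν} := by
  set S := {γ : ProbabilityMeasure (X × Y) |
      γ.map measurable_fst.aemeasurable = μ ∧ γ.map measurable_snd.aemeasurable = ν}
  have hclosed : IsClosed S :=
    (isClosed_eq (ProbabilityMeasure.continuous_map continuous_fst) continuous_const).inter
      (isClosed_eq (ProbabilityMeasure.continuous_map continuous_snd) continuous_const)
  rw [← hclosed.closure_eq]
  refine isCompact_closure_of_isTightMeasureSet
    (isTightMeasureSet_iff_exists_isCompact_measure_compl_le.2 fun ε hε ↦ ?_)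
  obtain ⟨K, hK, hKμ⟩ := isTightMeasureSet_iff_exists_isCompact_measure_compl_le.1
    (isTightMeasureSet_singleton (μ := (μ : Measure X))) (ε / 2) (ENNReal.half_pos hε.ne')
  obtain ⟨L, hL, hLν⟩ := isTightMeasureSet_iff_exists_isCompact_measure_compl_le.1
    (isTightMeasureSet_singleton (μ := (ν : Measure Y))) (ε / 2) (ENNReal.half_pos hε.ne')
  refine ⟨K ×ˢ L, hK.prod hL, ?_⟩
  rintro _ ⟨γ, ⟨hγμ, hγν⟩, rfl⟩
  have hfst : (γ : Measure (X × Y)) (Prod.fst ⁻¹' Kᶜ) ≤ ε / 2 := by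
    rw [← Measure.map_apply measurable_fst hK.measurableSet.compl,
      ← ProbabilityMeasure.toMeasure_map γ measurable_fst.aemeasurable, hγμ]
    exact hKμ _ rfl
  have hsnd : (γ : Measure (X × Y)) (Prod.snd ⁻¹' Lᶜ) ≤ ε / 2 := by
    rw [← Measure.map_apply measurable_snd hL.measurableSet.compl,
      ← ProbabilityMeasure.toMeasure_map γ measurable_snd.aemeasurable, hγν]
    exact hLν _ rfl
  calc (γ : Measure (X × Y)) (K ×ˢ L)ᶜ
      ≤ (γ : Measure (X × Y)) (Prod.fst ⁻¹' Kᶜ ∪ Prod.snd ⁻¹' Lᶜ) :=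
        measure_mono fun p hp ↦ by
          simpa [mem_prod, imp_iff_not_or] using hp
    _ ≤ ε / 2 + ε / 2 := (measure_union_le _ _).trans (add_le_add hfst hsnd)
    _ = ε := ENNReal.add_halves ε

/-- Existence of an optimal transport plan: for probability measures `μ`, `ν` on Polish
spaces and a lower semicontinuous cost `c : X × Y → [0, +∞]`, the infimum of the total
cost over transport plans is attained. -/
theorem exists_optimal_plan {X Y : Type*}
    [MeasurableSpace X] [TopologicalSpace X] [PolishSpace X] [BorelSpace X]
    [MeasurableSpace Y] [TopologicalSpace Y] [PolishSpace Y] [BorelSpace Y]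
    (μ : Measure X) (ν : Measure Y)
    [IsProbabilityMeasure μ] [IsProbabilityMeasure ν]
    (c : X × Y → ℝ≥0∞) (hc : LowerSemicontinuous c) :
    ∃ γ : Measure (X × Y), (IsProbabilityMeasure γ ∧
        γ.map Prod.fst = μ ∧ γ.map Prod.snd = ν) ∧
      ∫⁻ p, c p ∂γ =
        ⨅ γ' ∈ {γ' : Measure (X × Y) | IsProbabilityMeasure γ' ∧
          γ'.map Prod.fst = μ ∧ γ'.map Prod.snd = ν}, ∫⁻ p, c p ∂γ' := by
  let μ' : ProbabilityMeasure X := ⟨μ, inferInstance⟩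
  let ν' : ProbabilityMeasure Y := ⟨ν, inferInstance⟩
  have hmem : ∀ γ : ProbabilityMeasure (X × Y),
      (γ.map measurable_fst.aemeasurable = μ' ∧ γ.map measurable_snd.aemeasurable = ν') ↔
        (γ : Measure (X × Y)).map Prod.fst = μ ∧ (γ : Measure (X × Y)).map Prod.snd = ν :=
    fun γ ↦ and_congr Subtype.ext_iff Subtype.ext_iff
  obtain ⟨γ, hγ, hmin⟩ := LowerSemicontinuousOn.exists_isMinOn
    ⟨⟨μ.prod ν, inferInstance⟩, (hmem _).2 (by simp)⟩
    (isCompact_setOf_map_fst_eq_map_snd_eq μ' ν')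
    (hc.lowerSemicontinuous_lintegral.lowerSemicontinuousOn _)
  have hγ' := (hmem γ).1 hγ
  refine ⟨γ, ⟨inferInstance, hγ'⟩, le_antisymm ?_ ?_⟩
  · exact le_iInf₂ fun γ' h ↦ hmin (a := ⟨γ', h.1⟩) ((hmem ⟨γ', h.1⟩).2 h.2)
  · exact iInf₂_le (γ : Measure (X × Y)) ⟨inferInstance, hγ'⟩
end
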